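/- Let d ∈ ℕ, 1 < p ≤ 2 and r ≥ 0. Then there is a constant C > 0 such that for every f ∈ S^{r+2/p−1}_p W one has ‖f‖_{S^r_p A} ≤ C · ‖f‖_{S^{r+2/p−1}_p W}, i.e. S^{r+2/p−1}_p W ↪ S^r_p A. -/

import Mathlib

open MeasureTheory Real ENNReal

noncomputable section

namespace Paper

/-- The fundamental domain `[0,1)^d` of the `d`-dimensional torus `𝕋^d`. -/
def cube (d : ℕ) : Set (Fin d → ℝ) := Set.univ.pi fun _ => Set.Ico (0:ℝ) 1

/-- The trigonometric character `x ↦ e^{2π i k·x}`. -/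
def expk (d : ℕ) (k : Fin d → ℤ) (x : Fin d → ℝ) : ℂ :=
  Complex.exp (((2 * Real.pi * ∑ i, (k i : ℝ) * x i : ℝ) : ℂ) * Complex.I)

/-- Fourier coefficient `f̂(k) = ∫_{[0,1)^d} f(x) e^{-2π i k·x} dx`. -/
def fCoeff (d : ℕ) (f : (Fin d → ℝ) → ℂ) (k : Fin d → ℤ) : ℂ :=
  ∫ x in cube d, f x * expk d (-k) x

/-- The `L_q` (quasi-)norm on the torus, `q ∈ (0,∞]`, valued in `ℝ≥0∞`
(for `q = ∞` this is the essential supremum). -/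
def LqNorm (d : ℕ) (q : ℝ≥0∞) (f : (Fin d → ℝ) → ℂ) : ℝ≥0∞ :=
  eLpNorm f q (volume.restrict (cube d))

/-- The weight `∏_{i=1}^d (1+|k_i|)`. -/
def wt (d : ℕ) (k : Fin d → ℤ) : ℝ := ∏ i, (1 + |(k i : ℝ)|)

/-- The weighted Wiener (quasi-)norm `‖f‖_{S^r_θ A}`
(with the sup modification for `θ = ∞`); `A_θ` corresponds to `r = 0`,
the Wiener algebra `A` to `r = 0`, `θ = 1`. -/
def wienerNorm (d : ℕ) (r : ℝ) (θ : ℝ≥0∞) (f : (Fin d → ℝ) → ℂ) : ℝ≥0∞ :=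
  if θ = ∞ then ⨆ k : Fin d → ℤ, ENNReal.ofReal (wt d k ^ r) * (‖fCoeff d f k‖₊ : ℝ≥0∞)
  else (∑' k : Fin d → ℤ,
      (ENNReal.ofReal (wt d k ^ r) * (‖fCoeff d f k‖₊ : ℝ≥0∞)) ^ θ.toReal) ^ (1 / θ.toReal)

/-- Trigonometric polynomials with at most `m` terms. -/
def trigPoly (d m : ℕ) : Set ((Fin d → ℝ) → ℂ) :=
  {s | ∃ (Λ : Finset (Fin d → ℤ)) (a : (Fin d → ℤ) → ℂ),
    Λ.card ≤ m ∧ s = fun x => ∑ k ∈ Λ, a k * expk d k x}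

/-- Best `m`-term trigonometric approximation error of `f`, error measured by `X`. -/
def sigmaF (d m : ℕ) (X : ((Fin d → ℝ) → ℂ) → ℝ≥0∞) (f : (Fin d → ℝ) → ℂ) : ℝ≥0∞ :=
  ⨅ s ∈ trigPoly d m, X (f - s)

/-- The unit ball of the space (inside `L₁(𝕋^d)`) with (quasi-)norm `N`. -/
def unitBall (d : ℕ) (N : ((Fin d → ℝ) → ℂ) → ℝ≥0∞) : Set ((Fin d → ℝ) → ℂ) :=
  {f | IntegrableOn f (cube d) ∧ N f ≤ 1}

/-- Best `m`-term trigonometric width of the unit ball of `N`, error measured by `X`. -/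
def sigmaClass (d m : ℕ) (N X : ((Fin d → ℝ) → ℂ) → ℝ≥0∞) : ℝ≥0∞ :=
  ⨆ f ∈ unitBall d N, sigmaF d m X f

/-- `log*(m) = max (log₂ m) 1`. -/
def logStar (m : ℕ) : ℝ := max (Real.logb 2 m) 1

/-- Two-sided asymptotic equivalence `a_m ≍ b_m`. -/
def IsAsympEquiv (a : ℕ → ℝ≥0∞) (b : ℕ → ℝ) : Prop :=
  ∃ c C : ℝ, 0 < c ∧ 0 < C ∧ ∃ m₀ : ℕ, ∀ m : ℕ, m₀ ≤ m →
    ENNReal.ofReal (c * b m) ≤ a m ∧ a m ≤ ENNReal.ofReal (C * b m)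

/-- One-sided asymptotic bound `a_m ≲ b_m`. -/
def IsAsympLe (a : ℕ → ℝ≥0∞) (b : ℕ → ℝ) : Prop :=
  ∃ C : ℝ, 0 < C ∧ ∃ m₀ : ℕ, ∀ m : ℕ, m₀ ≤ m → a m ≤ ENNReal.ofReal (C * b m)

/-- Dyadic block `I_0 = {0}`, `I_n = {k : 2^{n-1} ≤ |k| < 2^n}` for `n ≥ 1`. -/
def blockF (n : ℕ) : Finset ℤ :=
  (Finset.Icc (-(2^n : ℤ)) (2^n)).filter fun k =>
    (n = 0 ∧ k = 0) ∨ (n ≠ 0 ∧ 2^(n-1) ≤ |k| ∧ |k| < 2^n)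

/-- The dyadic block projection `∑_{k ∈ I_j} f̂(k) e^{2π i k·x}`. -/
def blockProj (d : ℕ) (f : (Fin d → ℝ) → ℂ) (j : Fin d → ℕ) : (Fin d → ℝ) → ℂ :=
  fun x => ∑ k ∈ Fintype.piFinset (fun i => blockF (j i)), fCoeff d f k * expk d k x

/-- The mixed-smoothness Besov (quasi-)norm `‖f‖_{S^s_{p,θ}B}`
(with the sup modification for `θ = ∞`). -/
def besovNorm (d : ℕ) (s : ℝ) (p θ : ℝ≥0∞) (f : (Fin d → ℝ) → ℂ) : ℝ≥0∞ :=
  if θ = ∞ then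
    ⨆ j : Fin d → ℕ,
      ENNReal.ofReal ((2:ℝ) ^ (((∑ i, j i : ℕ) : ℝ) * s)) * LqNorm d p (blockProj d f j)
  else
    (∑' j : Fin d → ℕ,
      (ENNReal.ofReal ((2:ℝ) ^ (((∑ i, j i : ℕ) : ℝ) * s)) * LqNorm d p (blockProj d f j))
        ^ θ.toReal) ^ (1 / θ.toReal)

/-- The mixed-smoothness Sobolev norm `‖f‖_{S^s_p W}` (Littlewood–Paley form),
with `S^0_p W := L_p`. -/
def sobolevNorm (d : ℕ) (s : ℝ) (p : ℝ≥0∞) (f : (Fin d → ℝ) → ℂ) : ℝ≥0∞ :=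
  if s = 0 then LqNorm d p f
  else
    (∫⁻ x in cube d,
      ((∑' j : Fin d → ℕ,
        (ENNReal.ofReal ((2:ℝ) ^ (((∑ i, j i : ℕ) : ℝ) * s)) *
          (‖blockProj d f j x‖₊ : ℝ≥0∞)) ^ (2:ℕ)) ^ ((1:ℝ)/2)) ^ p.toReal) ^ (1 / p.toReal)

/-- Trigonometric polynomials with frequencies in `[-M,M]^d`. -/
def boxPoly (d M : ℕ) : Set ((Fin d → ℝ) → ℂ) :=
  {s | ∃ (Λ : Finset (Fin d → ℤ)) (a : (Fin d → ℤ) → ℂ),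
    (∀ k ∈ Λ, ∀ i, |k i| ≤ (M : ℤ)) ∧ s = fun x => ∑ k ∈ Λ, a k * expk d k x}

/-- Error of best approximation by trigonometric polynomials with
frequencies in `[-M,M]^d`, measured in `L_∞`. -/
def EBox (d M : ℕ) (f : (Fin d → ℝ) → ℂ) : ℝ≥0∞ :=
  ⨅ g ∈ boxPoly d M, LqNorm d ∞ (f - g)

/-- The `m`-th (non-linear) sampling width of the class of continuous functions
in the unit ball of `N`, error measured in `L_q`. -/
def samplingWidth (d m : ℕ) (N : ((Fin d → ℝ) → ℂ) → ℝ≥0∞) (q : ℝ≥0∞) : ℝ≥0∞ :=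
  ⨅ (t : Fin m → (Fin d → ℝ)) (_ : ∀ i, t i ∈ cube d)
    (R : (Fin m → ℂ) → ((Fin d → ℝ) → ℂ)),
    ⨆ f ∈ {f : (Fin d → ℝ) → ℂ | Continuous f ∧ N f ≤ 1},
      LqNorm d q (f - R fun i => f (t i))

open scoped ComplexConjugate InnerProductSpace

/-- Bessel's inequality for functions with values in a Hilbert space. -/
theorem sum_enorm_integral_sq_le {X κ E : Type*} [MeasurableSpace X] {μ : Measure X}
    [IsFiniteMeasure μ] [Fintype κ] [DecidableEq κ] [NormedAddCommGroup E]
    [InnerProductSpace ℂ E] [CompleteSpace E] {e : κ → X → ℂ}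
    (he : ∀ k, AEStronglyMeasurable (e k) μ) (hb : ∀ k x, ‖e k x‖ ≤ 1)
    (ho : ∀ k l, ∫ x, conj (e k x) * e l x ∂μ = if k = l then 1 else 0)
    {v : X → E} (hv : MemLp v 2 μ) :
    ∑ k, ‖∫ x, conj (e k x) • v x ∂μ‖ₑ ^ 2 ≤ ∫⁻ x, ‖v x‖ₑ ^ 2 ∂μ := by
  have hvi : Integrable v μ := hv.integrable one_le_two
  have hv2 : Integrable (fun x => ‖v x‖ ^ 2) μ := hv.integrable_norm_pow two_ne_zero
  have hce : ∀ k, AEStronglyMeasurable (fun x => conj (e k x)) μ := fun k =>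
    Complex.continuous_conj.comp_aestronglyMeasurable (he k)
  have hcb : ∀ k x, ‖conj (e k x)‖ ≤ 1 := fun k x => by simpa using hb k x
  have hki : ∀ k, Integrable (fun x => conj (e k x) • v x) μ := fun k =>
    hvi.bdd_smul 1 (hce k) (ae_of_all _ (hcb k))
  set V : κ → E := fun k => ∫ x, conj (e k x) • v x ∂μ with hV
  have hee : ∀ k l, Integrable (fun x => conj (e k x) * e l x) μ := fun k l =>
    (integrable_const (1 : ℝ)).mono' ((hce k).mul (he l)) (ae_of_all _ fun x => by
      simpa using mul_le_one₀ (hb k x) (norm_nonneg _) (hb l x))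
  have hPv : ∀ x, ⟪∑ k, e k x • V k, v x⟫_ℂ = ∑ k, ⟪V k, conj (e k x) • v x⟫_ℂ := fun x => by
    simp [mul_comm]
  have hPP : ∀ x, ⟪∑ k, e k x • V k, ∑ k, e k x • V k⟫_ℂ
      = ∑ k, ∑ l, (conj (e k x) * e l x) * ⟪V k, V l⟫_ℂ := fun x => by
    rw [sum_inner]
    refine Finset.sum_congr rfl fun k _ => ?_
    rw [inner_smul_left, inner_sum, Finset.mul_sum]
    exact Finset.sum_congr rfl fun l _ => by rw [inner_smul_right, mul_assoc]
  have i1 : Integrable (fun x => ⟪∑ k, e k x • V k, v x⟫_ℂ) μ := by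
    simp only [hPv]
    exact integrable_finsetSum _ fun k _ => (hki k).const_inner _
  have i2 : Integrable (fun x => ⟪∑ k, e k x • V k, ∑ k, e k x • V k⟫_ℂ) μ := by
    simp only [hPP]
    exact integrable_finsetSum _ fun k _ => integrable_finsetSum _ fun l _ =>
      (hee k l).mul_const _
  have e1 : ∫ x, ⟪∑ k, e k x • V k, v x⟫_ℂ ∂μ = ∑ k, (‖V k‖ : ℂ) ^ 2 := by
    simp only [hPv]
    rw [integral_finsetSum _ fun k _ => (hki k).const_inner _]
    refine Finset.sum_congr rfl fun k _ => ?_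
    rw [integral_inner (hki k), inner_self_eq_norm_sq_to_K]; simp
  have e2 : ∫ x, ⟪∑ k, e k x • V k, ∑ k, e k x • V k⟫_ℂ ∂μ = ∑ k, (‖V k‖ : ℂ) ^ 2 := by
    simp only [hPP]
    rw [integral_finsetSum _ fun k _ => integrable_finsetSum _ fun l _ => (hee k l).mul_const _]
    refine Finset.sum_congr rfl fun k _ => ?_
    rw [integral_finsetSum _ fun l _ => (hee k l).mul_const _]
    simp only [integral_mul_const, ho, ite_mul, one_mul, zero_mul, Finset.sum_ite_eq,
      Finset.mem_univ, if_true]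
    rw [inner_self_eq_norm_sq_to_K]; simp
  have r1 : ∫ x, (⟪∑ k, e k x • V k, v x⟫_ℂ).re ∂μ = ∑ k, ‖V k‖ ^ 2 := by
    have := integral_re i1
    simp only [RCLike.re_to_complex] at this
    rw [this, e1, Complex.re_sum]
    simp [← Complex.ofReal_pow]
  have r2 : ∫ x, (⟪∑ k, e k x • V k, ∑ k, e k x • V k⟫_ℂ).re ∂μ = ∑ k, ‖V k‖ ^ 2 := by
    have := integral_re i2
    simp only [RCLike.re_to_complex] at this
    rw [this, e2, Complex.re_sum]
    simp [← Complex.ofReal_pow]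
  have key : 0 ≤ ∫ x, (‖v x‖ ^ 2 - 2 * (⟪∑ k, e k x • V k, v x⟫_ℂ).re
      + (⟪∑ k, e k x • V k, ∑ k, e k x • V k⟫_ℂ).re) ∂μ := by
    refine integral_nonneg fun x => ?_
    have h := norm_sub_sq (𝕜 := ℂ) (∑ k, e k x • V k) (v x)
    have h' := inner_self_eq_norm_sq (𝕜 := ℂ) (∑ k, e k x • V k)
    simp only [RCLike.re_to_complex] at h h'
    simp only [Pi.zero_apply]
    rw [h']
    nlinarith [sq_nonneg ‖∑ k, e k x • V k - v x‖]
  have j1 : Integrable (fun x => 2 * (⟪∑ k, e k x • V k, v x⟫_ℂ).re) μ := i1.re.const_mul 2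
  have j12 : Integrable (fun x => ‖v x‖ ^ 2 - 2 * (⟪∑ k, e k x • V k, v x⟫_ℂ).re) μ := hv2.sub j1
  have j2 : Integrable (fun x => (⟪∑ k, e k x • V k, ∑ k, e k x • V k⟫_ℂ).re) μ := i2.re
  rw [integral_add j12 j2, integral_sub hv2 j1, integral_const_mul, r1, r2] at key
  have hfin : ∑ k, ‖V k‖ ^ 2 ≤ ∫ x, ‖v x‖ ^ 2 ∂μ := by linarith
  have h3 := ENNReal.ofReal_le_ofReal hfin
  rw [ENNReal.ofReal_sum_of_nonneg fun _ _ => by positivity,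
    ofReal_integral_eq_lintegral_ofReal hv2 (ae_of_all _ fun x => by positivity)] at h3
  simpa only [ENNReal.ofReal_pow (norm_nonneg _), ofReal_norm] using h3

theorem setLIntegral_Ioi_ite_le {q c : ℝ} (hq : q < -1) (hc : 0 < c) :
    ∫⁻ t in Set.Ioi (0 : ℝ), (if c ≤ t then ENNReal.ofReal (t ^ q) else 0)
      = ENNReal.ofReal (c ^ (q + 1) / (-(q + 1))) := by
  have h1 : ∀ t : ℝ, (if c ≤ t then ENNReal.ofReal (t ^ q) else 0)
      = (Set.Ici c).indicator (fun t => ENNReal.ofReal (t ^ q)) t := fun t => by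
    simp [Set.indicator_apply]
  simp only [h1]
  rw [setLIntegral_indicator measurableSet_Ici,
    Set.inter_eq_left.2 (Set.Ici_subset_Ioi.2 hc), ← restrict_Ioi_eq_restrict_Ici,
    ← ofReal_integral_eq_lintegral_ofReal (integrableOn_Ioi_rpow_of_lt hq hc)
      ((ae_restrict_mem measurableSet_Ioi).mono fun t (ht : c < t) =>
        rpow_nonneg (hc.trans ht).le _),
    integral_Ioi_rpow_of_lt hq hc]
  congr 1
  rw [div_neg, neg_div]

theorem setLIntegral_Ioi_ite_lt {q c : ℝ} (hq : -1 < q) (hc : 0 ≤ c) :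
    ∫⁻ t in Set.Ioi (0 : ℝ), (if t < c then ENNReal.ofReal (t ^ q) else 0)
      = ENNReal.ofReal (c ^ (q + 1) / (q + 1)) := by
  have h1 : ∀ t : ℝ, (if t < c then ENNReal.ofReal (t ^ q) else 0)
      = (Set.Iio c).indicator (fun t => ENNReal.ofReal (t ^ q)) t := fun t => by
    simp [Set.indicator_apply]
  have hi := (intervalIntegrable_iff_integrableOn_Ioc_of_le hc).1
    (intervalIntegral.intervalIntegrable_rpow' (a := 0) (b := c) hq)
  simp only [h1]
  rw [setLIntegral_indicator measurableSet_Iio, Set.inter_comm, Set.Ioi_inter_Iio,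
    restrict_Ioo_eq_restrict_Ioc,
    ← ofReal_integral_eq_lintegral_ofReal hi
      ((ae_restrict_mem measurableSet_Ioc).mono fun t ht => rpow_nonneg ht.1.le _),
    ← intervalIntegral.integral_of_le hc, integral_rpow (Or.inl hq),
    zero_rpow (by linarith), sub_zero]

/-- The distribution bound in the Marcinkiewicz argument: the contribution of the part `≤ t` is
controlled in `ℓ₂`, that of the part `> t` in `ℓ_∞`. -/
theorem sum_weight_le_of_split {κ : Type*} [Fintype κ] {D t : ℝ} (hD : 0 < D) (ht : 0 < t)
    {w y : κ → ℝ} (hw : ∀ k, 0 < w k)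
    (hwD : ∀ s > 0, ∑ k with s < w k, (w k ^ 2)⁻¹ ≤ D / s)
    {a : κ → ℝ≥0∞} {B : ℝ≥0∞} (hy : ∀ k, ENNReal.ofReal (y k) ≤ a k + B) :
    ∑ k with t < w k * y k, ENNReal.ofReal (w k ^ 2)⁻¹
      ≤ ENNReal.ofReal (4 / t ^ 2) * ∑ k, a k ^ 2 + ENNReal.ofReal (2 * D / t) * B := by
  rcases eq_or_ne B ∞ with rfl | hB
  · rw [ENNReal.mul_top (by simpa using by positivity)]; simp
  lift B to NNReal using hB
  have h1 : ∀ k, t < w k * y k → ENNReal.ofReal (w k ^ 2)⁻¹ ≤ ENNReal.ofReal (4 / t ^ 2) * a k ^ 2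
      + (if t / 2 < w k * B then ENNReal.ofReal (w k ^ 2)⁻¹ else 0) := by
    intro k hk
    split_ifs with h
    · exact le_add_self
    rw [add_zero]
    rcases eq_or_ne (a k) ∞ with ha | ha
    · rw [ha, ENNReal.top_pow two_ne_zero, ENNReal.mul_top (by simpa using by positivity)]; simp
    have hyk := hy k
    lift a k to NNReal using ha with A
    rw [← ENNReal.coe_add, ← ENNReal.ofReal_coe_nnreal,
      ENNReal.ofReal_le_ofReal_iff (by positivity)] at hyk
    rw [← ENNReal.ofReal_coe_nnreal, ← ENNReal.ofReal_pow (by positivity),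
      ← ENNReal.ofReal_mul (by positivity)]
    refine ENNReal.ofReal_le_ofReal ?_
    push_cast at hyk
    have h2 : t / 2 < w k * A := by nlinarith [mul_le_mul_of_nonneg_left hyk (hw k).le]
    have hwk := hw k
    rw [inv_le_iff_one_le_mul₀ (by positivity), div_mul_eq_mul_div, div_mul_eq_mul_div,
      one_le_div (by positivity)]
    nlinarith [mul_self_le_mul_self (by positivity) h2.le]
  have h2 : ∑ k with t / 2 < w k * B, ENNReal.ofReal (w k ^ 2)⁻¹
      ≤ ENNReal.ofReal (2 * D / t) * B := by
    rcases eq_or_ne B 0 with rfl | hB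
    · rw [Finset.filter_false_of_mem fun k _ => by simpa using by positivity]; simp
    have hB' : 0 < (B : ℝ) := by positivity
    have h3 := hwD (t / (2 * B)) (by positivity)
    have h4 : ∀ k, t / 2 < w k * B ↔ t / (2 * B) < w k := fun k => by
      rw [div_lt_iff₀ two_pos, div_lt_iff₀ (by positivity)]
      constructor <;> intro h <;> linarith
    simp only [h4]
    rw [← ENNReal.ofReal_sum_of_nonneg fun k _ => by have := hw k; positivity,
      ← ENNReal.ofReal_coe_nnreal, ← ENNReal.ofReal_mul (by positivity)]
    refine ENNReal.ofReal_le_ofReal (h3.trans_eq ?_)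
    field_simp
  calc _ ≤ ∑ k with t < w k * y k, (ENNReal.ofReal (4 / t ^ 2) * a k ^ 2
      + (if t / 2 < w k * B then ENNReal.ofReal (w k ^ 2)⁻¹ else 0)) :=
        Finset.sum_le_sum fun k hk => h1 k (Finset.mem_filter.1 hk).2
    _ ≤ ∑ k, (ENNReal.ofReal (4 / t ^ 2) * a k ^ 2
      + (if t / 2 < w k * B then ENNReal.ofReal (w k ^ 2)⁻¹ else 0)) :=
        Finset.sum_le_sum_of_subset (Finset.filter_subset _ _)
    _ = ENNReal.ofReal (4 / t ^ 2) * ∑ k, a k ^ 2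
      + ∑ k with t / 2 < w k * B, ENNReal.ofReal (w k ^ 2)⁻¹ := by
        rw [Finset.sum_add_distrib, Finset.mul_sum, Finset.sum_filter]
    _ ≤ _ := by gcongr

/-- A discrete Marcinkiewicz interpolation inequality between `ℓ₂` and weak `ℓ₁` bounds. -/
theorem sum_weight_rpow_le_lintegral {X κ : Type*} [MeasurableSpace X] {μ : Measure X}
    [SFinite μ] [Fintype κ] {p D : ℝ} (hp1 : 1 < p) (hp2 : p < 2) (hD : 0 < D)
    {w y : κ → ℝ} (hw : ∀ k, 0 < w k) (hy : ∀ k, 0 ≤ y k)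
    (hwD : ∀ s > 0, ∑ k with s < w k, (w k ^ 2)⁻¹ ≤ D / s)
    {G : X → ℝ} (hG : Measurable G) (hG0 : ∀ x, 0 ≤ G x)
    (h : ∀ t > 0, ∃ a : κ → ℝ≥0∞,
      (∀ k, ENNReal.ofReal (y k) ≤ a k + ∫⁻ x in {x | t < G x}, ENNReal.ofReal (G x) ∂μ) ∧
      ∑ k, a k ^ 2 ≤ ∫⁻ x in {x | G x ≤ t}, ENNReal.ofReal (G x ^ 2) ∂μ) :
    ∑ k, ENNReal.ofReal (w k ^ (p - 2) * y k ^ p)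
      ≤ ENNReal.ofReal (p * (4 / (2 - p) + 2 * D / (p - 1)))
        * ∫⁻ x, ENNReal.ofReal (G x ^ p) ∂μ := by
  let : MeasurableSpace κ := ⊤
  set ν : Measure κ := ∑ k, ENNReal.ofReal (w k ^ 2)⁻¹ • Measure.dirac k with hν
  have hL : ∑ k, ENNReal.ofReal (w k ^ (p - 2) * y k ^ p)
      = ∫⁻ k, ENNReal.ofReal ((w k * y k) ^ p) ∂ν := by
    rw [hν, lintegral_finsetSum_measure]
    refine Finset.sum_congr rfl fun k _ => ?_
    have hwk := hw k
    rw [lintegral_smul_measure, lintegral_dirac, smul_eq_mul, ← ENNReal.ofReal_mul (by positivity),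
      mul_rpow hwk.le (hy k), rpow_sub hwk, Real.rpow_two]
    congr 1; ring
  have hνS : ∀ t : ℝ, ν {k | t < w k * y k}
      = ∑ k with t < w k * y k, ENNReal.ofReal (w k ^ 2)⁻¹ := fun t => by
    rw [hν, Measure.finsetSum_apply, Finset.sum_filter]
    refine Finset.sum_congr rfl fun k _ => ?_
    rw [Measure.smul_apply, Measure.dirac_apply]
    simp [Set.indicator_apply]
  rw [hL, lintegral_rpow_eq_lintegral_meas_lt_mul ν
    (ae_of_all _ fun k => mul_nonneg (hw k).le (hy k)) (measurable_from_top.aemeasurable)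
    (by linarith)]
  set F₁ : ℝ → X → ℝ≥0∞ := fun t x =>
    ENNReal.ofReal (4 * G x ^ 2) * (if G x ≤ t then ENNReal.ofReal (t ^ (p - 3)) else 0) with hF₁
  set F₂ : ℝ → X → ℝ≥0∞ := fun t x =>
    ENNReal.ofReal (2 * D * G x) * (if t < G x then ENNReal.ofReal (t ^ (p - 2)) else 0) with hF₂
  have mF₁ : Measurable (Function.uncurry F₁) := by
    refine ((hG.comp measurable_snd).pow_const 2 |>.const_mul 4).ennreal_ofReal.mul ?_
    exact Measurable.ite (measurableSet_le (hG.comp measurable_snd) measurable_fst)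
      (measurable_fst.pow_const _).ennreal_ofReal measurable_const
  have mF₂ : Measurable (Function.uncurry F₂) := by
    refine ((hG.comp measurable_snd).const_mul (2 * D)).ennreal_ofReal.mul ?_
    exact Measurable.ite (measurableSet_lt measurable_fst (hG.comp measurable_snd))
      (measurable_fst.pow_const _).ennreal_ofReal measurable_const
  have hpt : ∀ t ∈ Set.Ioi (0 : ℝ), ν {k | t < w k * y k} * ENNReal.ofReal (t ^ (p - 1))
      ≤ ∫⁻ x, F₁ t x ∂μ + ∫⁻ x, F₂ t x ∂μ := by
    intro t (ht : 0 < t)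
    obtain ⟨a, ha, ha2⟩ := h t ht
    rw [hνS]
    have e₁ : ENNReal.ofReal (4 / t ^ 2) * (∫⁻ x in {x | G x ≤ t}, ENNReal.ofReal (G x ^ 2) ∂μ)
        * ENNReal.ofReal (t ^ (p - 1)) = ∫⁻ x, F₁ t x ∂μ := by
      rw [mul_right_comm, ← ENNReal.ofReal_mul (by positivity),
        ← lintegral_indicator (measurableSet_le hG measurable_const),
        ← lintegral_const_mul _ ((hG.pow_const 2).ennreal_ofReal.indicator
          (measurableSet_le hG measurable_const))]
      refine lintegral_congr fun x => ?_
      simp only [hF₁, Set.indicator_apply, Set.mem_ofPred_eq]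
      split_ifs
      · rw [← ENNReal.ofReal_mul (by positivity), ← ENNReal.ofReal_mul (by positivity),
          show p - 3 = p - 1 - 2 by ring, rpow_sub ht (p - 1) 2, Real.rpow_two]
        congr 1; ring
      · simp
    have e₂ : ENNReal.ofReal (2 * D / t) * (∫⁻ x in {x | t < G x}, ENNReal.ofReal (G x) ∂μ)
        * ENNReal.ofReal (t ^ (p - 1)) = ∫⁻ x, F₂ t x ∂μ := by
      rw [mul_right_comm, ← ENNReal.ofReal_mul (by positivity),
        ← lintegral_indicator (measurableSet_lt measurable_const hG),
        ← lintegral_const_mul _ (hG.ennreal_ofReal.indicator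
          (measurableSet_lt measurable_const hG))]
      refine lintegral_congr fun x => ?_
      have := hG0 x
      simp only [hF₂, Set.indicator_apply, Set.mem_ofPred_eq]
      split_ifs
      · rw [← ENNReal.ofReal_mul (by positivity), ← ENNReal.ofReal_mul (by positivity),
          show p - 2 = p - 1 - 1 by ring, rpow_sub ht (p - 1) 1, Real.rpow_one]
        congr 1; ring
      · simp
    calc _ ≤ (ENNReal.ofReal (4 / t ^ 2) * ∑ k, a k ^ 2 + ENNReal.ofReal (2 * D / t)
          * ∫⁻ x in {x | t < G x}, ENNReal.ofReal (G x) ∂μ) * ENNReal.ofReal (t ^ (p - 1)) := by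
          gcongr
          exact sum_weight_le_of_split hD ht hw hwD ha
      _ ≤ (ENNReal.ofReal (4 / t ^ 2) * (∫⁻ x in {x | G x ≤ t}, ENNReal.ofReal (G x ^ 2) ∂μ)
          + ENNReal.ofReal (2 * D / t)
          * ∫⁻ x in {x | t < G x}, ENNReal.ofReal (G x) ∂μ) * ENNReal.ofReal (t ^ (p - 1)) := by
          gcongr
      _ = _ := by rw [add_mul, e₁, e₂]
  have hI₁ : ∀ x, ∫⁻ t in Set.Ioi (0 : ℝ), F₁ t x ≤ ENNReal.ofReal (4 / (2 - p) * G x ^ p) := by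
    intro x
    have hm : Measurable fun t : ℝ => if G x ≤ t then ENNReal.ofReal (t ^ (p - 3)) else 0 :=
      Measurable.ite (measurableSet_le measurable_const measurable_id)
        (measurable_id.pow_const _).ennreal_ofReal measurable_const
    simp only [hF₁]
    rw [lintegral_const_mul _ hm]
    rcases (hG0 x).eq_or_lt with h0 | h0
    · simp [← h0]
    rw [setLIntegral_Ioi_ite_le (by linarith) h0, ← ENNReal.ofReal_mul (by positivity)]
    refine ENNReal.ofReal_le_ofReal (le_of_eq ?_)
    rw [show p - 3 + 1 = p - 2 by ring, rpow_sub h0, Real.rpow_two]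
    have : 2 - p ≠ 0 := by linarith
    rw [neg_sub]
    field_simp
  have hI₂ : ∀ x, ∫⁻ t in Set.Ioi (0 : ℝ), F₂ t x
      ≤ ENNReal.ofReal (2 * D / (p - 1) * G x ^ p) := by
    intro x
    have hm : Measurable fun t : ℝ => if t < G x then ENNReal.ofReal (t ^ (p - 2)) else 0 :=
      Measurable.ite (measurableSet_lt measurable_id measurable_const)
        (measurable_id.pow_const _).ennreal_ofReal measurable_const
    have hx := hG0 x
    simp only [hF₂]
    rw [lintegral_const_mul _ hm]
    rcases hx.eq_or_lt with h0 | h0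
    · simp [← h0]
    rw [setLIntegral_Ioi_ite_lt (by linarith) hx, ← ENNReal.ofReal_mul (by positivity)]
    refine ENNReal.ofReal_le_ofReal (le_of_eq ?_)
    rw [show p - 2 + 1 = p - 1 by ring, rpow_sub h0, Real.rpow_one]
    have : p - 1 ≠ 0 := by linarith
    field_simp
  have hp1' : 0 < p - 1 := by linarith
  have hp2' : 0 < 2 - p := by linarith
  calc _ ≤ ENNReal.ofReal p * ∫⁻ t in Set.Ioi (0 : ℝ), (∫⁻ x, F₁ t x ∂μ + ∫⁻ x, F₂ t x ∂μ) := by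
        gcongr 1
        exact setLIntegral_mono' measurableSet_Ioi hpt
    _ = ENNReal.ofReal p * ∫⁻ x, ((∫⁻ t in Set.Ioi (0 : ℝ), F₁ t x)
          + ∫⁻ t in Set.Ioi (0 : ℝ), F₂ t x) ∂μ := by
        have m₁ : Measurable fun t => ∫⁻ x, F₁ t x ∂μ := mF₁.lintegral_prod_right'
        have m₂ : Measurable fun x => ∫⁻ t in Set.Ioi (0 : ℝ), F₁ t x := mF₁.lintegral_prod_left'
        rw [lintegral_add_left m₁, lintegral_add_left m₂,
          lintegral_lintegral_swap mF₁.aemeasurable, lintegral_lintegral_swap mF₂.aemeasurable]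
    _ ≤ ENNReal.ofReal p * ∫⁻ x, ENNReal.ofReal (4 / (2 - p) + 2 * D / (p - 1))
          * ENNReal.ofReal (G x ^ p) ∂μ := by
        gcongr with x
        have := rpow_nonneg (hG0 x) p
        rw [← ENNReal.ofReal_mul (by positivity), add_mul, ENNReal.ofReal_add (by positivity)
          (by positivity)]
        exact add_le_add (hI₁ x) (hI₂ x)
    _ = _ := by
        rw [lintegral_const_mul _ (hG.pow_const _).ennreal_ofReal, ← mul_assoc,
          ← ENNReal.ofReal_mul (by linarith)]

/-- A Hardy-Littlewood inequality for Fourier coefficients, with respect to a bounded orthonormal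
system, of functions with values in a Hilbert space. -/
theorem sum_weight_enorm_integral_rpow_le {X κ E : Type*} [MeasurableSpace X] {μ : Measure X}
    [IsFiniteMeasure μ] [Fintype κ] [DecidableEq κ] [NormedAddCommGroup E]
    [InnerProductSpace ℂ E] [CompleteSpace E] {p D : ℝ} (hp1 : 1 < p) (hp2 : p ≤ 2) (hD : 0 < D)
    {w : κ → ℝ} (hw : ∀ k, 0 < w k) (hwD : ∀ s > 0, ∑ k with s < w k, (w k ^ 2)⁻¹ ≤ D / s)
    {e : κ → X → ℂ} (he : ∀ k, StronglyMeasurable (e k)) (hb : ∀ k x, ‖e k x‖ ≤ 1)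
    (ho : ∀ k l, ∫ x, conj (e k x) * e l x ∂μ = if k = l then 1 else 0)
    {v : X → E} (hv : StronglyMeasurable v) {M : ℝ} (hM : ∀ x, ‖v x‖ ≤ M) :
    ∑ k, ENNReal.ofReal (w k ^ (p - 2)) * ‖∫ x, conj (e k x) • v x ∂μ‖ₑ ^ p
      ≤ ENNReal.ofReal (1 + p * (4 / (2 - p) + 2 * D / (p - 1))) * ∫⁻ x, ‖v x‖ₑ ^ p ∂μ := by
  have hp1' : 0 < p - 1 := by linarith
  have hp2' : 0 ≤ 2 - p := by linarith
  have he' : ∀ k, AEStronglyMeasurable (e k) μ := fun k => (he k).aestronglyMeasurable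
  rcases hp2.eq_or_lt with rfl | hp2
  · have h := sum_enorm_integral_sq_le he' hb ho
      (MemLp.of_bound hv.aestronglyMeasurable M (ae_of_all _ hM))
    simp only [sub_self, Real.rpow_zero, ENNReal.ofReal_one, one_mul, ENNReal.rpow_two]
    refine h.trans (le_mul_of_one_le_left zero_le (ENNReal.one_le_ofReal.2 ?_))
    have : 0 ≤ (2 : ℝ) * (4 / 0 + 2 * D / (2 - 1)) := by positivity
    linarith
  have hvi : Integrable v μ := .of_bound hv.aestronglyMeasurable M (ae_of_all _ hM)
  have hce : ∀ k, AEStronglyMeasurable (fun x => conj (e k x)) μ := fun k =>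
    Complex.continuous_conj.comp_aestronglyMeasurable (he' k)
  have hki : ∀ k, Integrable (fun x => conj (e k x) • v x) μ := fun k =>
    hvi.bdd_smul 1 (hce k) (ae_of_all _ fun x => by simpa using hb k x)
  have hvm : Measurable fun x => ‖v x‖ := hv.norm.measurable
  have key := sum_weight_rpow_le_lintegral (μ := μ) hp1 hp2 hD hw
    (y := fun k => ‖∫ x, conj (e k x) • v x ∂μ‖) (fun k => norm_nonneg _) hwD
    (G := fun x => ‖v x‖) hvm (fun x => norm_nonneg _) ?_
  · calc _ = ∑ k, ENNReal.ofReal (w k ^ (p - 2) * ‖∫ x, conj (e k x) • v x ∂μ‖ ^ p) := by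
          refine Finset.sum_congr rfl fun k _ => ?_
          rw [ENNReal.ofReal_mul (rpow_nonneg (hw k).le _),
            ← ENNReal.ofReal_rpow_of_nonneg (norm_nonneg _) (by linarith), ofReal_norm]
      _ ≤ _ := key
      _ ≤ _ := by
          simp only [← ENNReal.ofReal_rpow_of_nonneg (norm_nonneg _) (zero_le_one.trans hp1.le),
            ofReal_norm]
          gcongr
          linarith
  intro t _
  have hs : MeasurableSet {x | ‖v x‖ ≤ t} := measurableSet_le hvm measurable_const
  have hc : {x | ‖v x‖ ≤ t}ᶜ = {x | t < ‖v x‖} := by ext; simp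
  refine ⟨fun k => ‖∫ x, conj (e k x) • {x | ‖v x‖ ≤ t}.indicator v x ∂μ‖ₑ, fun k => ?_, ?_⟩
  · have h1 : ∫ x, conj (e k x) • {x | ‖v x‖ ≤ t}.indicator v x ∂μ
        = ∫ x in {x | ‖v x‖ ≤ t}, conj (e k x) • v x ∂μ := by
      rw [← integral_indicator hs]
      congr 1; ext x
      simp only [Set.indicator_apply]
      split_ifs <;> simp
    beta_reduce
    rw [ofReal_norm, h1, ← integral_add_compl hs (hki k), hc]
    refine (enorm_add_le _ _).trans ?_
    gcongr
    refine (enorm_integral_le_lintegral_enorm _).trans (lintegral_mono fun x => ?_)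
    rw [enorm_smul, ofReal_norm]
    refine mul_le_of_le_one_left zero_le ?_
    rw [← ofReal_norm]
    exact ENNReal.ofReal_le_one.2 (by simpa using hb k x)
  · have hm : MemLp ({x | ‖v x‖ ≤ t}.indicator v) 2 μ :=
      (MemLp.of_bound hv.aestronglyMeasurable M (ae_of_all _ hM)).indicator hs
    refine (sum_enorm_integral_sq_le he' hb ho hm).trans (le_of_eq ?_)
    rw [← lintegral_indicator hs]
    refine lintegral_congr fun x => ?_
    simp only [Set.indicator_apply]
    split_ifs
    · rw [ENNReal.ofReal_pow (norm_nonneg _), ofReal_norm]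
    · simp

/-- The Hardy-Littlewood inequality for products of one-dimensional systems, by induction on the
dimension. -/
theorem sum_prod_weight_enorm_integral_pi_rpow_le {κ E : Type*} {μ : Measure ℝ}
    [IsProbabilityMeasure μ] [Fintype κ] [DecidableEq κ] [NormedAddCommGroup E]
    [InnerProductSpace ℂ E] [CompleteSpace E] {p : ℝ} {C : ℝ≥0∞}
    {w : κ → ℝ} (hw : ∀ k, 0 < w k)
    {e : κ → ℝ → ℂ} (he : ∀ k, StronglyMeasurable (e k)) (hb : ∀ k x, ‖e k x‖ ≤ 1)
    (h : ∀ (v : ℝ → E) (M : ℝ), StronglyMeasurable v → (∀ x, ‖v x‖ ≤ M) →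
      ∑ k, ENNReal.ofReal (w k ^ (p - 2)) * ‖∫ x, conj (e k x) • v x ∂μ‖ₑ ^ p
        ≤ C * ∫⁻ x, ‖v x‖ₑ ^ p ∂μ) (d : ℕ) (g : (Fin d → ℝ) → E) (M : ℝ)
    (hg : StronglyMeasurable g) (hM : ∀ x, ‖g x‖ ≤ M) :
    ∑ k : Fin d → κ, ENNReal.ofReal ((∏ i, w (k i)) ^ (p - 2))
        * ‖∫ x, conj (∏ i, e (k i) (x i)) • g x ∂(Measure.pi fun _ => μ)‖ₑ ^ p
      ≤ C ^ d * ∫⁻ x, ‖g x‖ₑ ^ p ∂(Measure.pi fun _ => μ) := by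
  induction d with
  | zero =>
    rw [Measure.pi_of_empty]
    simp [lintegral_dirac]
  | succ d ih =>
    set ρ : Measure (Fin d → ℝ) := Measure.pi fun _ => μ with hρ
    have mp := (measurePreserving_piFinSuccAbove (fun _ : Fin (d + 1) => μ) 0).symm
    have hcons : ∀ z : ℝ × (Fin d → ℝ),
        (MeasurableEquiv.piFinSuccAbove (fun _ : Fin (d + 1) => ℝ) 0).symm z
          = Fin.cons z.1 z.2 := fun z => by
      simp [MeasurableEquiv.piFinSuccAbove_symm_apply, Fin.insertNthEquiv]
    have mcons : Measurable fun z : ℝ × (Fin d → ℝ) => (Fin.cons z.1 z.2 : Fin (d + 1) → ℝ) := by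
      rw [← funext hcons]
      exact (MeasurableEquiv.piFinSuccAbove (fun _ : Fin (d + 1) => ℝ) 0).symm.measurable
    have hgc : StronglyMeasurable fun z : ℝ × (Fin d → ℝ) => g (Fin.cons z.1 z.2) :=
      hg.comp_measurable mcons
    have hE : ∀ k : Fin d → κ, StronglyMeasurable fun x : Fin d → ℝ => conj (∏ i, e (k i) (x i)) :=
      fun k => Complex.continuous_conj.comp_stronglyMeasurable
        (Finset.stronglyMeasurable_fun_prod _ fun i _ => (he (k i)).comp_measurable
          (measurable_pi_apply i))
    have hEb : ∀ (k : Fin d → κ) (x : Fin d → ℝ), ‖conj (∏ i, e (k i) (x i))‖ ≤ 1 := fun k x => by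
      rw [RCLike.norm_conj, norm_prod]
      exact Finset.prod_le_one (fun _ _ => norm_nonneg _) fun i _ => hb _ _
    have hF : ∀ k : Fin d → κ, StronglyMeasurable fun z : ℝ × (Fin d → ℝ) =>
        conj (∏ i, e (k i) (z.2 i)) • g (Fin.cons z.1 z.2) := fun k =>
      ((hE k).comp_measurable measurable_snd).smul hgc
    set v : (Fin d → κ) → ℝ → E := fun k x₀ =>
      ∫ x, conj (∏ i, e (k i) (x i)) • g (Fin.cons x₀ x) ∂ρ with hvdef
    have hvm : ∀ k, StronglyMeasurable (v k) := fun k => (hF k).integral_prod_right'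
    have hFb : ∀ (k : Fin d → κ) (z : ℝ × (Fin d → ℝ)),
        ‖conj (∏ i, e (k i) (z.2 i)) • g (Fin.cons z.1 z.2)‖ ≤ M := fun k z => by
      rw [norm_smul]
      exact (mul_le_of_le_one_left (norm_nonneg _) (hEb _ _)).trans (hM _)
    have hvb : ∀ k x₀, ‖v k x₀‖ ≤ M := fun k x₀ =>
      (norm_integral_le_of_norm_le_const (μ := ρ)
        (ae_of_all _ fun x => hFb k (x₀, x))).trans_eq (by simp)
    have hcoef : ∀ (k₀ : κ) (k : Fin d → κ),
        ∫ x, conj (∏ i, e ((Fin.cons k₀ k : Fin (d + 1) → κ) i) (x i)) • g x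
            ∂(Measure.pi fun _ => μ)
          = ∫ x₀, conj (e k₀ x₀) • v k x₀ ∂μ := fun k₀ k => by
      rw [← mp.integral_comp']
      simp only [hcons, Fin.prod_univ_succ, Fin.cons_zero, Fin.cons_succ, map_mul, mul_smul]
      rw [integral_prod]
      · simp only [integral_smul, hvdef, hρ]
      · refine .of_bound (StronglyMeasurable.aestronglyMeasurable ?_) M (ae_of_all _ fun z => ?_)
        · exact (Complex.continuous_conj.comp_stronglyMeasurable
            ((he k₀).comp_measurable measurable_fst)).smul (hF k)
        · rw [norm_smul, RCLike.norm_conj]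
          exact (mul_le_of_le_one_left (norm_nonneg _) (hb _ _)).trans (hFb k z)
    calc _ = ∑ k : Fin d → κ, ∑ k₀ : κ, ENNReal.ofReal ((∏ i, w (k i)) ^ (p - 2))
          * (ENNReal.ofReal (w k₀ ^ (p - 2)) * ‖∫ x₀, conj (e k₀ x₀) • v k x₀ ∂μ‖ₑ ^ p) := by
          rw [← (Fin.consEquiv fun _ : Fin (d + 1) => κ).sum_comp, Fintype.sum_prod_type_right]
          refine Finset.sum_congr rfl fun k _ => Finset.sum_congr rfl fun k₀ _ => ?_
          have := hcoef k₀ k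
          simp only [Fin.consEquiv, Equiv.coe_fn_mk]
          rw [this, Fin.prod_univ_succ, ← mul_assoc, ← ENNReal.ofReal_mul
            (rpow_nonneg (Finset.prod_nonneg fun i _ => (hw _).le) _), ← mul_rpow
            (Finset.prod_nonneg fun i _ => (hw _).le) (hw _).le]
          simp only [Fin.cons_zero, Fin.cons_succ, mul_comm]
      _ ≤ ∑ k : Fin d → κ, ENNReal.ofReal ((∏ i, w (k i)) ^ (p - 2))
          * (C * ∫⁻ x₀, ‖v k x₀‖ₑ ^ p ∂μ) := by
          simp only [← Finset.mul_sum]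
          gcongr with k
          exact h (v k) M (hvm k) (hvb k)
      _ = C * ∫⁻ x₀, ∑ k : Fin d → κ, ENNReal.ofReal ((∏ i, w (k i)) ^ (p - 2))
          * ‖v k x₀‖ₑ ^ p ∂μ := by
          have hm : ∀ k, Measurable fun x₀ => ‖v k x₀‖ₑ ^ p := fun k =>
            (hvm k).enorm.pow_const p
          rw [lintegral_finsetSum _ fun k _ => (hm k).const_mul _, Finset.mul_sum]
          refine Finset.sum_congr rfl fun k _ => ?_
          rw [lintegral_const_mul _ (hm k)]
          ring
      _ ≤ C * ∫⁻ x₀, C ^ d * ∫⁻ x, ‖g (Fin.cons x₀ x)‖ₑ ^ p ∂ρ ∂μ := by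
          gcongr with x₀
          exact ih (fun x => g (Fin.cons x₀ x))
            (hgc.comp_measurable measurable_prodMk_left) fun x => hM _
      _ = _ := by
          have hm : Measurable fun z : ℝ × (Fin d → ℝ) => ‖g (Fin.cons z.1 z.2)‖ₑ ^ p :=
            hgc.enorm.pow_const p
          rw [lintegral_const_mul _ hm.lintegral_prod_right', ← mul_assoc, ← pow_succ',
            ← mp.lintegral_comp_emb (MeasurableEquiv.measurableEmbedding _)]
          simp only [hcons]
          rw [lintegral_prod _ hm.aemeasurable]

theorem restrict_cube_eq_pi (d : ℕ) : (volume.restrict (cube d) : Measure (Fin d → ℝ))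
    = Measure.pi fun _ => volume.restrict (Set.Ico (0 : ℝ) 1) := by
  rw [volume_pi, cube, Measure.restrict_pi_pi]

instance : IsProbabilityMeasure (volume.restrict (Set.Ico (0 : ℝ) 1)) :=
  ⟨by simp⟩

/-- The univariate trigonometric character `x ↦ e^{2π i n x}`. -/
def expOne (n : ℤ) (x : ℝ) : ℂ := Complex.exp (((2 * Real.pi * (n * x) : ℝ) : ℂ) * Complex.I)

theorem continuous_expOne (n : ℤ) : Continuous (expOne n) := by
  unfold expOne; fun_prop

theorem norm_expOne (n : ℤ) (x : ℝ) : ‖expOne n x‖ = 1 := Complex.norm_exp_ofReal_mul_I _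

theorem conj_expOne_mul_expOne (k l : ℤ) (x : ℝ) :
    conj (expOne k x) * expOne l x = Complex.exp ((2 * Real.pi * (l - k : ℤ) * Complex.I) * x) := by
  simp only [expOne, ← Complex.exp_conj, ← Complex.exp_add, map_mul, Complex.conj_ofReal,
    Complex.conj_I]
  congr 1
  push_cast
  ring

theorem integral_conj_expOne_mul_expOne (k l : ℤ) :
    ∫ x in Set.Ico (0 : ℝ) 1, conj (expOne k x) * expOne l x = if k = l then 1 else 0 := by
  simp only [conj_expOne_mul_expOne]
  rw [integral_Ico_eq_integral_Ioc, ← intervalIntegral.integral_of_le zero_le_one]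
  split_ifs with h
  · simp [h]
  · have hc : (2 * Real.pi * (l - k : ℤ) * Complex.I : ℂ) ≠ 0 := by
      have h' : ((l - k : ℤ) : ℂ) ≠ 0 := by exact_mod_cast sub_ne_zero.2 (Ne.symm h)
      have hpi : (Real.pi : ℂ) ≠ 0 := by exact_mod_cast Real.pi_ne_zero
      exact mul_ne_zero (mul_ne_zero (mul_ne_zero two_ne_zero hpi) h') Complex.I_ne_zero
    rw [integral_exp_mul_complex hc, _root_.div_eq_zero_iff]
    left
    have : (2 * Real.pi * (l - k : ℤ) * Complex.I * (1 : ℝ) : ℂ)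
        = (l - k : ℤ) * (2 * Real.pi * Complex.I) := by push_cast; ring
    rw [this, Complex.exp_int_mul_two_pi_mul_I]
    simp

theorem expk_eq_prod (d : ℕ) (k : Fin d → ℤ) (x : Fin d → ℝ) :
    expk d k x = ∏ i, expOne (k i) (x i) := by
  simp only [expk, expOne, ← Complex.exp_sum, Finset.mul_sum, Complex.ofReal_sum, Finset.sum_mul]

theorem expk_neg (d : ℕ) (k : Fin d → ℤ) (x : Fin d → ℝ) :
    expk d (-k) x = conj (expk d k x) := by
  simp only [expk, ← Complex.exp_conj, map_mul, Complex.conj_ofReal, Complex.conj_I]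
  simp

theorem continuous_expk (d : ℕ) (k : Fin d → ℤ) : Continuous (expk d k) := by
  unfold expk; fun_prop

theorem norm_expk (d : ℕ) (k : Fin d → ℤ) (x : Fin d → ℝ) : ‖expk d k x‖ = 1 :=
  Complex.norm_exp_ofReal_mul_I _

theorem integral_conj_expk_mul_expk (d : ℕ) (k l : Fin d → ℤ) :
    ∫ x in cube d, conj (expk d k x) * expk d l x = if k = l then 1 else 0 := by
  simp only [restrict_cube_eq_pi, expk_eq_prod, map_prod, ← Finset.prod_mul_distrib]
  rw [integral_fintype_prod_eq_prod (fun i x => conj (expOne (k i) x) * expOne (l i) x)]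
  simp only [integral_conj_expOne_mul_expOne, Finset.prod_ite_zero, Finset.prod_const_one,
    Finset.mem_univ, true_imp_iff, funext_iff]

theorem fCoeff_eq (d : ℕ) (f : (Fin d → ℝ) → ℂ) (k : Fin d → ℤ) :
    fCoeff d f k = ∫ x in cube d, conj (expk d k x) • f x := by
  simp only [fCoeff, expk_neg, smul_eq_mul, mul_comm]

instance (d : ℕ) : IsProbabilityMeasure (volume.restrict (cube d)) := by
  rw [restrict_cube_eq_pi]; infer_instance

theorem continuous_blockProj (d : ℕ) (f : (Fin d → ℝ) → ℂ) (j : Fin d → ℕ) :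
    Continuous (blockProj d f j) := by
  unfold blockProj
  exact continuous_finsetSum _ fun k _ => continuous_const.mul (continuous_expk d k)

theorem norm_blockProj_le (d : ℕ) (f : (Fin d → ℝ) → ℂ) (j : Fin d → ℕ) (x : Fin d → ℝ) :
    ‖blockProj d f j x‖ ≤ ∑ k ∈ Fintype.piFinset (fun i => blockF (j i)), ‖fCoeff d f k‖ := by
  unfold blockProj
  refine (norm_sum_le _ _).trans_eq (Finset.sum_congr rfl fun k _ => ?_)
  rw [norm_mul, norm_expk, mul_one]

theorem integral_conj_expk_mul_blockProj (d : ℕ) (f : (Fin d → ℝ) → ℂ) {j : Fin d → ℕ}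
    {k : Fin d → ℤ} (hk : k ∈ Fintype.piFinset (fun i => blockF (j i))) :
    ∫ x in cube d, conj (expk d k x) * blockProj d f j x = fCoeff d f k := by
  have hi : ∀ l, Integrable (fun x => fCoeff d f l * (conj (expk d k x) * expk d l x))
      (volume.restrict (cube d)) := fun l =>
    (Integrable.of_bound ((Complex.continuous_conj.comp (continuous_expk d k)).mul
      (continuous_expk d l)).aestronglyMeasurable 1
      (ae_of_all _ fun x => by simp [norm_expk])).const_mul _
  simp only [blockProj, Finset.mul_sum, mul_left_comm]
  rw [integral_finsetSum _ fun l _ => hi l]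
  simp only [integral_const_mul, integral_conj_expk_mul_expk, mul_ite, mul_one, mul_zero]
  rw [Finset.sum_ite_eq, if_pos hk]

theorem mem_blockF_size (n : ℤ) : n ∈ blockF n.natAbs.size := by
  have h1 : |n| < 2 ^ n.natAbs.size := by
    rw [Int.abs_eq_natAbs]; exact_mod_cast Nat.lt_size_self _
  rw [blockF, Finset.mem_filter, Finset.mem_Icc]
  refine ⟨abs_le.1 h1.le, ?_⟩
  rcases eq_or_ne n 0 with rfl | hn
  · simp
  · have h0 : n.natAbs.size ≠ 0 := by simpa [Nat.size_eq_zero] using hn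
    refine Or.inr ⟨h0, ?_, h1⟩
    rw [Int.abs_eq_natAbs]
    exact_mod_cast Nat.lt_size.1 (Nat.sub_lt (Nat.pos_of_ne_zero h0) one_pos)

theorem wt_pos (d : ℕ) (k : Fin d → ℤ) : 0 < wt d k :=
  Finset.prod_pos fun i _ => by positivity

theorem wt_le_two_pow (d : ℕ) (k : Fin d → ℤ) :
    wt d k ≤ (2 : ℝ) ^ (∑ i, (k i).natAbs.size) := by
  rw [← Finset.prod_pow_eq_pow_sum, wt]
  refine Finset.prod_le_prod (fun i _ => by positivity) fun i _ => ?_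
  have h : (k i).natAbs + 1 ≤ 2 ^ (k i).natAbs.size := Nat.lt_size_self _
  have h' : ((k i).natAbs : ℝ) + 1 ≤ 2 ^ (k i).natAbs.size := by exact_mod_cast h
  rw [Nat.cast_natAbs, Int.cast_abs] at h'
  linarith

theorem sum_inv_sq_one_add_abs_le (K : Finset ℤ) {s : ℝ} (hs : 0 < s) :
    ∑ n ∈ Finset.univ.filter fun n : K => s < 1 + |((n : ℤ) : ℝ)|, ((1 + |((n : ℤ) : ℝ)|) ^ 2)⁻¹
      ≤ 4 / s := by
  rw [Finset.sum_filter, Finset.sum_coe_sort K fun n : ℤ =>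
    if s < 1 + |(n : ℝ)| then ((1 + |(n : ℝ)|) ^ 2)⁻¹ else 0, ← Finset.sum_filter]
  set T := K.filter fun n : ℤ => s < 1 + |(n : ℝ)|
  set N := T.sup Int.natAbs + 2
  have hmaps : ∀ n ∈ T, n.natAbs + 1 ∈ Finset.Ioo ⌊s⌋₊ N := by
    intro n hn
    have h1 : s < 1 + |(n : ℝ)| := (Finset.mem_filter.1 hn).2
    have h2 : n.natAbs ≤ T.sup Int.natAbs := Finset.le_sup (f := Int.natAbs) hn
    rw [Finset.mem_Ioo]
    refine ⟨(Nat.floor_lt hs.le).2 ?_, by omega⟩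
    rw [Nat.cast_add, Nat.cast_natAbs, Int.cast_abs]
    push_cast
    linarith
  rw [← Finset.sum_fiberwise_of_maps_to hmaps]
  calc _ ≤ ∑ m ∈ Finset.Ioo ⌊s⌋₊ N, 2 * ((m : ℝ) ^ 2)⁻¹ := by
        refine Finset.sum_le_sum fun m _ => ?_
        have hc : (T.filter fun n : ℤ => n.natAbs + 1 = m).card ≤ 2 := by
          refine (Finset.card_le_card (t := {(m : ℤ) - 1, -((m : ℤ) - 1)}) fun n hn => ?_).trans
            Finset.card_le_two
          have := (Finset.mem_filter.1 hn).2
          simp only [Finset.mem_insert, Finset.mem_singleton]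
          omega
        have hval : ∀ n ∈ T.filter fun n : ℤ => n.natAbs + 1 = m,
            ((1 + |(n : ℝ)|) ^ 2)⁻¹ = ((m : ℝ) ^ 2)⁻¹ := fun n hn => by
          rw [← (Finset.mem_filter.1 hn).2, Nat.cast_add, Nat.cast_natAbs, Int.cast_abs, add_comm]
          simp
        rw [Finset.sum_congr rfl hval, Finset.sum_const, nsmul_eq_mul]
        gcongr
        exact_mod_cast hc
    _ ≤ 2 * (2 / (⌊s⌋₊ + 1)) := by
        rw [← Finset.mul_sum]
        gcongr
        exact sum_Ioo_inv_sq_le _ _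
    _ ≤ 2 * (2 / s) := by
        gcongr
        exact (Nat.lt_floor_add_one s).le
    _ = 4 / s := by ring

/-- Bessel's inequality on the torus. -/
theorem tsum_enorm_fCoeff_sq_le (d : ℕ) {f : (Fin d → ℝ) → ℂ} (hf : IntegrableOn f (cube d)) :
    ∑' k, ‖fCoeff d f k‖ₑ ^ 2 ≤ ∫⁻ x in cube d, ‖f x‖ₑ ^ 2 := by
  by_cases htop : ∫⁻ x in cube d, ‖f x‖ₑ ^ 2 = ∞
  · exact htop ▸ le_top
  have hm : MemLp f 2 (volume.restrict (cube d)) := by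
    refine ⟨hf.aestronglyMeasurable, ?_⟩
    rw [eLpNorm_lt_top_iff_lintegral_rpow_enorm_lt_top two_ne_zero ENNReal.ofNat_ne_top]
    simpa [lt_top_iff_ne_top] using htop
  rw [ENNReal.tsum_eq_iSup_sum]
  refine iSup_le fun F => ?_
  have h := sum_enorm_integral_sq_le (κ := F) (e := fun k => expk d k)
    (fun k => (continuous_expk d k).aestronglyMeasurable) (fun k x => (norm_expk d k x).le)
    (fun k l => by simp only [integral_conj_expk_mul_expk, Subtype.ext_iff]) hm
  simp only [← fCoeff_eq] at h
  rwa [Finset.sum_coe_sort F fun k => ‖fCoeff d f k‖ₑ ^ 2] at h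

theorem enorm_sq_eq_sum {J : Type*} [Fintype J] (x : EuclideanSpace ℂ J) :
    ‖x‖ₑ ^ 2 = ∑ j, ‖x j‖ₑ ^ 2 := by
  simp only [← ofReal_norm, ← ENNReal.ofReal_pow (norm_nonneg _), EuclideanSpace.norm_sq_eq]
  exact ENNReal.ofReal_sum_of_nonneg fun _ _ => by positivity

theorem enorm_eq_sum_rpow {J : Type*} [Fintype J] (x : EuclideanSpace ℂ J) :
    ‖x‖ₑ = (∑ j, ‖x j‖ₑ ^ 2) ^ ((1 : ℝ) / 2) := by
  rw [← enorm_sq_eq_sum, ← ENNReal.rpow_natCast_mul]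
  norm_num

theorem weight_mul_rpow_le {q r : ℝ} (hq : 0 < q) (hs : 0 ≤ r + 2 / q - 1) {w b : ℝ} (hw : 0 < w)
    (hwb : w ≤ b) (z : ℝ≥0∞) :
    (ENNReal.ofReal (w ^ r) * z) ^ q
      ≤ ENNReal.ofReal (w ^ (q - 2)) * (ENNReal.ofReal (b ^ (r + 2 / q - 1)) * z) ^ q := by
  have hexp : r * q = (q - 2) + (r + 2 / q - 1) * q := by field_simp; ring
  rw [ENNReal.mul_rpow_of_nonneg _ _ hq.le, ENNReal.mul_rpow_of_nonneg _ _ hq.le, ← mul_assoc,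
    ENNReal.ofReal_rpow_of_nonneg (by positivity) hq.le,
    ENNReal.ofReal_rpow_of_nonneg (Real.rpow_nonneg (hw.le.trans hwb) _) hq.le,
    ← ENNReal.ofReal_mul (by positivity), ← Real.rpow_mul hw.le, hexp, Real.rpow_add hw,
    Real.rpow_mul hw.le]
  gcongr

/-- The embedding for positive Sobolev smoothness, before taking the `q`-th root. -/
theorem tsum_weight_enorm_fCoeff_rpow_le (d : ℕ) {q r : ℝ} (hq1 : 1 < q) (hq2 : q ≤ 2)
    (hs : 0 ≤ r + 2 / q - 1) (f : (Fin d → ℝ) → ℂ) :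
    ∑' k, (ENNReal.ofReal (wt d k ^ r) * ‖fCoeff d f k‖ₑ) ^ q
      ≤ ENNReal.ofReal (1 + q * (4 / (2 - q) + 2 * 4 / (q - 1))) ^ d *
        ∫⁻ x in cube d, ((∑' j : Fin d → ℕ,
          (ENNReal.ofReal ((2 : ℝ) ^ (((∑ i, j i : ℕ) : ℝ) * (r + 2 / q - 1))) *
            ‖blockProj d f j x‖ₑ) ^ 2) ^ ((1 : ℝ) / 2)) ^ q := by
  have hq0 : 0 < q := by linarith
  set s := r + 2 / q - 1 with hsdef
  set c : (Fin d → ℕ) → ℝ := fun j => (2 : ℝ) ^ (((∑ i, j i : ℕ) : ℝ) * s) with hc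
  have hc0 : ∀ j, 0 ≤ c j := fun j => by positivity
  rw [ENNReal.tsum_eq_iSup_sum]
  refine iSup_le fun F => ?_
  set σ : (Fin d → ℤ) → Fin d → ℕ := fun k i => (k i).natAbs.size
  set K : Finset ℤ := F.biUnion fun k => Finset.univ.image k
  set J : Finset (Fin d → ℕ) := F.image σ
  have hkK : ∀ k ∈ F, ∀ i, k i ∈ K := fun k hk i =>
    Finset.mem_biUnion.2 ⟨k, hk, Finset.mem_image_of_mem _ (Finset.mem_univ i)⟩
  let g : (Fin d → ℝ) → EuclideanSpace ℂ J := fun x =>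
    WithLp.toLp 2 fun j => (c j : ℂ) * blockProj d f j x
  have hgc : Continuous g := (PiLp.continuous_toLp 2 _).comp
    (continuous_pi fun j => continuous_const.mul (continuous_blockProj d f j))
  obtain ⟨M, hM⟩ : ∃ M, ∀ x, ‖g x‖ ≤ M := by
    refine ⟨Real.sqrt (∑ j : J, (c j *
      ∑ k ∈ Fintype.piFinset (fun i => blockF (j.1 i)), ‖fCoeff d f k‖) ^ 2), fun x => ?_⟩
    rw [EuclideanSpace.norm_eq]
    refine Real.sqrt_le_sqrt (Finset.sum_le_sum fun j _ => ?_)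
    rw [norm_mul, Complex.norm_of_nonneg (hc0 _)]
    gcongr
    exact norm_blockProj_le d f j x
  have hgi : ∀ k, Integrable (fun x => conj (expk d k x) • g x) (volume.restrict (cube d)) :=
    fun k => .of_bound ((Complex.continuous_conj.comp
      (continuous_expk d k)).smul hgc).aestronglyMeasurable M (ae_of_all _ fun x => by
        rw [norm_smul, RCLike.norm_conj, norm_expk, one_mul]; exact hM x)
  have hcoef : ∀ k ∈ F, ENNReal.ofReal (c (σ k)) * ‖fCoeff d f k‖ₑ
      ≤ ‖∫ x in cube d, conj (expk d k x) • g x‖ₑ := fun k hk => by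
    have hj : σ k ∈ J := Finset.mem_image_of_mem _ hk
    have hcoord : (∫ x in cube d, conj (expk d k x) • g x) ⟨σ k, hj⟩
        = (c (σ k) : ℂ) * fCoeff d f k := by
      have h := (EuclideanSpace.proj (𝕜 := ℂ) (⟨σ k, hj⟩ : J)).integral_comp_comm (hgi k)
      simp only [PiLp.proj_apply] at h
      rw [← h, ← integral_conj_expk_mul_blockProj d f (j := σ k)
        (Fintype.mem_piFinset.2 fun i => mem_blockF_size (k i)), ← integral_const_mul]
      refine integral_congr_ae (ae_of_all _ fun x => ?_)
      simp only [PiLp.smul_apply, smul_eq_mul, g]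
      ring
    have hle := PiLp.enorm_apply_le (∫ x in cube d, conj (expk d k x) • g x) ⟨σ k, hj⟩
    rwa [hcoord, enorm_mul, ← ofReal_norm (c (σ k) : ℂ), Complex.norm_of_nonneg (hc0 _)] at hle
  have hbase : ∀ k, c (σ k) = ((2 : ℝ) ^ (∑ i, (k i).natAbs.size)) ^ s := fun k => by
    rw [hc, ← Real.rpow_natCast, ← Real.rpow_mul zero_le_two]
  have hHL := sum_prod_weight_enorm_integral_pi_rpow_le (κ := K)
    (μ := volume.restrict (Set.Ico (0 : ℝ) 1)) (p := q)
    (w := fun n => 1 + |((n : ℤ) : ℝ)|) (e := fun n => expOne n) (fun n => by positivity)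
    (fun n => (continuous_expOne n).stronglyMeasurable) (fun n x => (norm_expOne n x).le)
    (fun v M hv hM => sum_weight_enorm_integral_rpow_le hq1 hq2 four_pos
      (fun n => by positivity) (fun s hs => sum_inv_sq_one_add_abs_le K hs)
      (fun n => (continuous_expOne n).stronglyMeasurable) (fun n x => (norm_expOne n x).le)
      (fun k l => by simp only [integral_conj_expOne_mul_expOne, Subtype.ext_iff]) hv hM)
    d g M hgc.stronglyMeasurable hM
  simp only [← restrict_cube_eq_pi, ← expk_eq_prod] at hHL
  calc ∑ k ∈ F, (ENNReal.ofReal (wt d k ^ r) * ‖fCoeff d f k‖ₑ) ^ q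
      ≤ ∑ k ∈ F, ENNReal.ofReal (wt d k ^ (q - 2)) *
          ‖∫ x in cube d, conj (expk d k x) • g x‖ₑ ^ q := by
        refine Finset.sum_le_sum fun k hk => ?_
        refine (weight_mul_rpow_le hq0 hs (wt_pos d k) (wt_le_two_pow d k) _).trans ?_
        gcongr
        rw [← hsdef, ← hbase]
        exact hcoef k hk
    _ = ∑ k : F, ENNReal.ofReal (wt d k ^ (q - 2)) *
          ‖∫ x in cube d, conj (expk d k x) • g x‖ₑ ^ q := (Finset.sum_coe_sort F _).symm
    _ ≤ ∑ k : Fin d → K, ENNReal.ofReal (wt d (fun i => k i) ^ (q - 2)) *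
          ‖∫ x in cube d, conj (expk d (fun i => k i) x) • g x‖ₑ ^ q := by
        let ι : F → Fin d → K := fun k i => ⟨k.1 i, hkK k.1 k.2 i⟩
        have hι : Function.Injective ι := fun k l hkl => Subtype.ext <| funext fun i =>
          congrArg Subtype.val (congrFun hkl i)
        rw [← Finset.sum_image (s := Finset.univ) (g := ι) (f := fun k : Fin d → K =>
          ENNReal.ofReal (wt d (fun i => k i) ^ (q - 2)) *
          ‖∫ x in cube d, conj (expk d (fun i => k i) x) • g x‖ₑ ^ q) hι.injOn]
        exact Finset.sum_le_sum_of_subset (Finset.subset_univ _)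
    _ ≤ _ := hHL
    _ ≤ _ := by
        gcongr with x
        rw [enorm_eq_sum_rpow]
        gcongr
        refine le_trans (le_of_eq ?_) (ENNReal.sum_le_tsum J)
        rw [← Finset.sum_coe_sort J]
        refine Finset.sum_congr rfl fun j _ => ?_
        rw [enorm_mul, ← ofReal_norm (c j : ℂ), Complex.norm_of_nonneg (hc0 _)]

/-- the embedding `S^{r+2/p-1}_p W ↪ S^r_p A`
for `1 < p ≤ 2`, `r ≥ 0`. -/
theorem statement9 (d : ℕ) (hd : 1 ≤ d) (p : ℝ≥0∞) (hp1 : 1 < p) (hp2 : p ≤ 2)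
    (r : ℝ) (hr : 0 ≤ r) :
    ∃ C : ℝ, 0 < C ∧ ∀ f : (Fin d → ℝ) → ℂ, IntegrableOn f (cube d) →
      wienerNorm d r p f ≤
        ENNReal.ofReal C * sobolevNorm d (r + 2/p.toReal - 1) p f := by
  have hptop : p ≠ ∞ := ne_top_of_le_ne_top ENNReal.ofNat_ne_top hp2
  lift p to NNReal using hptop
  obtain ⟨q, hq⟩ : ∃ q : ℝ, (p : ℝ) = q := ⟨_, rfl⟩
  have hq1 : 1 < q := by rw [← hq]; exact_mod_cast hp1
  have hq2 : q ≤ 2 := by rw [← hq]; exact_mod_cast hp2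
  have hq0 : 0 < q := by linarith
  have h2q : 1 ≤ 2 / q := (one_le_div hq0).2 hq2
  simp only [wienerNorm, sobolevNorm, ENNReal.coe_ne_top, if_false, ENNReal.coe_toReal, hq,
    ← enorm_eq_nnnorm]
  by_cases hs : r + 2 / q - 1 = 0
  · have hr0 : r = 0 := by linarith
    have hq2' : q = 2 := by
      have : 2 / q = 1 := by linarith
      field_simp at this
      exact this.symm
    subst hr0 hq2'
    have hp : (p : ℝ≥0∞) = 2 := by
      have : p = 2 := NNReal.eq hq
      rw [this]; rfl
    refine ⟨1, one_pos, fun f hf => ?_⟩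
    rw [if_pos hs, LqNorm, hp, eLpNorm_eq_lintegral_rpow_enorm_toReal two_ne_zero
      ENNReal.ofNat_ne_top]
    simp only [Real.rpow_zero, ENNReal.ofReal_one, one_mul, ENNReal.toReal_ofNat,
      ENNReal.rpow_two]
    gcongr
    exact tsum_enorm_fCoeff_sq_le d hf
  · set A : ℝ := 1 + q * (4 / (2 - q) + 2 * 4 / (q - 1))
    have hA : 0 < A := by
      have h1 : 0 ≤ 2 - q := by linarith
      have h2 : 0 < q - 1 := by linarith
      positivity
    refine ⟨(A ^ d) ^ (1 / q), by positivity, fun f _ => ?_⟩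
    rw [if_neg hs, ← ENNReal.ofReal_rpow_of_pos (by positivity), ENNReal.ofReal_pow hA.le,
      ← ENNReal.mul_rpow_of_nonneg _ _ (by positivity)]
    gcongr
    exact tsum_weight_enorm_fCoeff_rpow_le d hq1 hq2 (by linarith) f

end Paper
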